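/- arXiv:2603.08454 — 2 statements merged into one kernel-verified Lean document; each statement's English description precedes it below -/
import Mathlib

section
/- Let G be a graph (possibly with parallel edges), let δ be a singular infinite cardinal, and let (δ_α)_{α<cf(δ)} be an increasing sequence of regular cardinals converging to δ with cf(δ) < δ₀. For every α < cf(δ), let H_α be the simple graph on the vertex set of G in which two vertices x, y are adjacent if and only if κ_V(x, y) ≥ δ_α in G. Suppose there exists a choice of a–b paths P_α in H_α for every α < cf(δ) (not necessarily distinct) such that P_α and P_β are order-compatible for all α ≠ β. Then G contains δ pairwise edge-disjoint a–b paths that are pairwise order-compatible. -/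
universe u

/-- A multigraph: possibly parallel edges, no loops. Each edge `e` has a pair of
distinct endpoints `ends e`. -/
structure Multigraph (V : Type u) (E : Type u) : Type u where
  ends : E → Sym2 V
  not_loop : ∀ e, ¬ (ends e).IsDiag

namespace Multigraph

variable {V E : Type u}

/-- A path from `a` to `b` in a multigraph, given by its (duplicate-free) list of
vertices, traversed from `a` to `b`, together with the list of edges it uses. -/
structure Path (G : Multigraph V E) (a b : V) : Type u where
  verts : List V
  edges : List E
  nodup : verts.Nodup
  length_eq : verts.length = edges.length + 1
  head_eq : verts.head? = some a
  last_eq : verts.getLast? = some b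
  inc : ∀ i, ∀ h : i + 1 < verts.length,
    G.ends (edges[i]'(by omega)) = s(verts[i]'(by omega), verts[i + 1]'h)

variable {G : Multigraph V E}

/-- The length of a path is its number of edges. -/
def Path.length {a b : V} (P : G.Path a b) : ℕ := P.edges.length

/-- Two paths are edge-disjoint if they share no edge. -/
def EdgeDisjoint {a b a' b' : V} (P : G.Path a b) (Q : G.Path a' b') : Prop :=
  ∀ e, e ∈ P.edges → e ∉ Q.edges

/-- Two (oriented) paths are order-compatible if their common vertices occur in the
same order along both. -/
def OrderCompatible {a b a' b' : V} (P : G.Path a b) (Q : G.Path a' b') : Prop :=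
  ∀ u v : V, u ∈ P.verts → v ∈ P.verts → u ∈ Q.verts → v ∈ Q.verts →
    ([u, v].Sublist P.verts ↔ [u, v].Sublist Q.verts)

/-- Two `a`–`b` paths are internally disjoint if they meet only in `a` and `b`. -/
def InternallyDisjoint {a b : V} (P Q : G.Path a b) : Prop :=
  ∀ x, x ∈ P.verts → x ∈ Q.verts → x = a ∨ x = b

/-- `κ_V(a,b) ≥ δ`: there are `δ` pairwise internally vertex-disjoint `a`–`b` paths. -/
def KappaVGe (G : Multigraph V E) (a b : V) (δ : Cardinal.{u}) : Prop :=
  ∃ S : Set (G.Path a b), S.Pairwise InternallyDisjoint ∧ δ ≤ Cardinal.mk S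

end Multigraph

/-- Order-compatibility for (oriented) vertex lists of paths. -/
def listOrderCompatible {V : Type u} (L M : List V) : Prop :=
  ∀ u v : V, u ∈ L → v ∈ L → u ∈ M → v ∈ M → ([u, v].Sublist L ↔ [u, v].Sublist M)

namespace Multigraph

variable {V E : Type u} {G : Multigraph V E}

/-- An edge of a path joins two consecutive vertices of it. -/
theorem Path.exists_ends_eq {a b : V} (P : G.Path a b) {e : E} (he : e ∈ P.edges) :
    ∃ u v, [u, v] <:+: P.verts ∧ G.ends e = s(u, v) := by
  obtain ⟨i, hi, rfl⟩ := List.getElem_of_mem he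
  have hl := P.length_eq
  refine ⟨P.verts[i], P.verts[i + 1], ⟨P.verts.take i, P.verts.drop (i + 2), ?_⟩,
    P.inc i (by omega)⟩
  conv_rhs => rw [← List.take_append_drop i P.verts, List.drop_eq_getElem_cons (by omega),
    List.drop_eq_getElem_cons (by omega)]
  simp

/-- A path using an edge between its end-vertices consists of that edge only. -/
theorem Path.edges_eq_singleton {a b : V} (P : G.Path a b) {e : E} (he : e ∈ P.edges)
    (h : ∀ x ∈ G.ends e, x = a ∨ x = b) : P.verts = [a, b] ∧ P.edges = [e] := by
  obtain ⟨verts, edges, nodup, hl, hd, lt, inc⟩ := P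
  obtain ⟨i, hi, rfl⟩ := List.getElem_of_mem he
  dsimp only at hi he h ⊢
  rw [inc i (by omega)] at h
  have h1 := h verts[i] (by simp)
  have h2 := h verts[i + 1] (by simp)
  have ha : a = verts[0]'(by omega) := by
    rw [List.head?_eq_getElem?, List.getElem?_eq_getElem (by omega)] at hd
    simpa using hd.symm
  have hb : b = verts[edges.length]'(by omega) := by
    rw [List.getLast?_eq_getElem?, List.getElem?_eq_getElem (by omega)] at lt
    simp only [hl, Nat.add_sub_cancel, Option.some.injEq] at lt
    exact lt.symm
  rw [ha, hb, nodup.getElem_inj_iff, nodup.getElem_inj_iff] at h1 h2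
  have hn : edges.length = 1 := by omega
  obtain rfl : i = 0 := by omega
  obtain ⟨e, rfl⟩ := List.length_eq_one_iff.1 hn
  obtain ⟨x, y, rfl⟩ := List.length_eq_two.1 hl
  simp_all

/-- Internally disjoint paths sharing an edge are equal. -/
theorem InternallyDisjoint.eq_of_mem_edges {a b : V} {P Q : G.Path a b}
    (h : InternallyDisjoint P Q) {e : E} (hP : e ∈ P.edges) (hQ : e ∈ Q.edges) : P = Q := by
  have hmem : ∀ (R : G.Path a b), e ∈ R.edges → ∀ x ∈ G.ends e, x ∈ R.verts := by
    intro R hR x hx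
    obtain ⟨u, v, huv, he⟩ := R.exists_ends_eq hR
    rw [he, Sym2.mem_iff] at hx
    exact huv.subset (by simpa using hx)
  have hab : ∀ x ∈ G.ends e, x = a ∨ x = b := fun x hx => h x (hmem P hP x hx) (hmem Q hQ x hx)
  have h1 := P.edges_eq_singleton hP hab
  have h2 := Q.edges_eq_singleton hQ hab
  cases P; cases Q
  simp_all

/-- Few vertices and edges can be avoided by a path between two vertices of large
connectivity. -/
theorem KappaVGe.exists_path {x y : V} {κ : Cardinal.{u}} (hκ : Cardinal.aleph0 ≤ κ)
    (h : G.KappaVGe x y κ) {X : Set V} {F : Set E} (hX : Cardinal.mk X < κ)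
    (hF : Cardinal.mk F < κ) :
    ∃ P : G.Path x y, (∀ v ∈ P.verts, v ∈ X → v = x ∨ v = y) ∧ ∀ e ∈ P.edges, e ∉ F := by
  obtain ⟨S, hS, hle⟩ := h
  by_contra! hcon
  have hbad : ∀ P : S, ∃ z : X ⊕ F,
      (∀ v, z = Sum.inl v → v.1 ∈ P.1.verts ∧ ¬ (v.1 = x ∨ v.1 = y)) ∧
      (∀ e, z = Sum.inr e → e.1 ∈ P.1.edges) := by
    intro P
    by_cases hP : ∀ v ∈ P.1.verts, v ∈ X → v = x ∨ v = y
    · obtain ⟨e, he, heF⟩ := hcon P.1 hP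
      exact ⟨Sum.inr ⟨e, heF⟩, by simp, by rintro _ ⟨⟩; exact he⟩
    · push Not at hP
      obtain ⟨v, hv, hvX, hxy⟩ := hP
      exact ⟨Sum.inl ⟨v, hvX⟩, by rintro _ ⟨⟩; exact ⟨hv, by simpa using hxy⟩, by simp⟩
  choose f hfv hfe using hbad
  have hinj : Function.Injective f := by
    intro P Q hPQ
    by_contra hne
    have hd := hS P.2 Q.2 (fun h => hne (Subtype.ext h))
    rcases hz : f P with v | e
    · exact (hfv P v hz).2 (hd v (hfv P v hz).1 (hfv Q v (hPQ ▸ hz)).1)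
    · exact hne (Subtype.ext (hd.eq_of_mem_edges (hfe P e hz) (hfe Q e (hPQ ▸ hz))))
  have := hle.trans (Cardinal.mk_le_of_injective hinj)
  rw [Cardinal.mk_sum, Cardinal.lift_id, Cardinal.lift_id] at this
  exact this.not_gt (Cardinal.add_lt_of_lt hκ hX hF)

/-- The trivial path. -/
def Path.nil (G : Multigraph V E) (a : V) : G.Path a a where
  verts := [a]
  edges := []
  nodup := by simp
  length_eq := rfl
  head_eq := rfl
  last_eq := rfl
  inc i h := by simp at h

/-- Concatenation of two paths meeting only in the end-vertex of the first. -/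
def Path.append {a b c : V} (P : G.Path a b) (Q : G.Path b c)
    (h : P.verts.dropLast.Disjoint Q.verts) : G.Path a c where
  verts := P.verts.dropLast ++ Q.verts
  edges := P.edges ++ Q.edges
  nodup := (P.nodup.sublist (List.dropLast_sublist _)).append Q.nodup h
  length_eq := by simp [P.length_eq, Q.length_eq, add_assoc]
  head_eq := by
    obtain ⟨verts, edges, nodup, hl, hd, lt, inc⟩ := P
    match verts, hd with
    | [x], hd =>
      obtain rfl : x = b := by simpa using lt
      simpa [Q.head_eq] using hd
    | x :: y :: l, hd => simpa using hd
  last_eq := by simp [List.getLast?_append, Q.last_eq]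
  inc i hi := by
    have hP := P.length_eq
    have hQ := Q.length_eq
    simp only [List.length_append, List.length_dropLast] at hi
    have h0 : Q.verts[0]'(by omega) = b := by
      have := Q.head_eq
      rw [List.head?_eq_getElem?, List.getElem?_eq_getElem (by omega)] at this
      simpa using this
    have hb : P.verts[P.edges.length]'(by omega) = b := by
      have := P.last_eq
      rw [List.getLast?_eq_getElem?, List.getElem?_eq_getElem (by omega)] at this
      simp only [hP, Nat.add_sub_cancel, Option.some.injEq] at this
      exact this
    rcases lt_trichotomy (i + 1) P.edges.length with hlt | heq | hgt
    · rw [List.getElem_append_left (by omega), List.getElem_append_left (by simp; omega),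
        List.getElem_append_left (by simp; omega), P.inc i (by omega)]
      simp
    · rw [List.getElem_append_left (by omega), List.getElem_append_left (by simp; omega),
        List.getElem_append_right (by simp; omega), P.inc i (by omega)]
      simp [hP, heq, h0, hb]
    · have e1 : i - P.verts.dropLast.length = i - P.edges.length := by simp [hP]
      have e2 : i + 1 - P.verts.dropLast.length = i - P.edges.length + 1 := by
        simp [hP]; omega
      rw [List.getElem_append_right (by omega), List.getElem_append_right (by simp; omega),
        List.getElem_append_right (by simp; omega), Q.inc (i - P.edges.length) (by omega)]
      simp only [e1, e2]

theorem Path.verts_eq_dropLast_append {a b : V} (P : G.Path a b) :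
    P.verts = P.verts.dropLast ++ [b] := by
  have := P.last_eq
  obtain ⟨l, hl⟩ := List.getLast?_eq_some_iff.1 this
  simp [hl]

/-- A list of vertices whose consecutive members are highly connected expands to a path
which avoids few given vertices and edges. -/
theorem exists_path_of_isChain {κ : Cardinal.{u}} (hκ : Cardinal.aleph0 ≤ κ) {b : V}
    (L : List V) {F : Set E} (hF : Cardinal.mk F < κ) :
    ∀ {a : V} {X : Set V}, Cardinal.mk X < κ → L.Nodup → L.head? = some a →
      L.getLast? = some b → L.IsChain (fun x y => x ≠ y ∧ G.KappaVGe x y κ) →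
      ∃ P : G.Path a b, L.Sublist P.verts ∧ (∀ v ∈ P.verts, v ∈ X → v ∈ L) ∧
        ∀ e ∈ P.edges, e ∉ F := by
  induction L with
  | nil => simp
  | cons x L ih =>
    intro a X hX hnd hhd hlt hch
    obtain rfl : x = a := by simpa using hhd
    match L with
    | [] =>
      obtain rfl : x = b := by simpa using hlt
      exact ⟨Path.nil G x, by simp [Path.nil]⟩
    | y :: L =>
      rw [List.isChain_cons_cons] at hch
      have hfin : ∀ l : List V, Cardinal.mk {v | v ∈ l} < κ := fun l =>
        (Cardinal.mk_lt_aleph0_iff.2 (List.finite_toSet l)).trans_le hκ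
      have hun : ∀ {Y Z : Set V}, Cardinal.mk Y < κ → Cardinal.mk Z < κ →
          Cardinal.mk (Y ∪ Z : Set V) < κ := fun hY hZ =>
        (Cardinal.mk_union_le _ _).trans_lt (Cardinal.add_lt_of_lt hκ hY hZ)
      obtain ⟨Q, hLQ, hQX, hQF⟩ := ih (a := y) (X := X ∪ {v | v ∈ [x]}) (hun hX (hfin _))
        hnd.of_cons rfl (by simpa using hlt) hch.2
      have hxQ : x ∉ Q.verts := fun hx =>
        (List.nodup_cons.1 hnd).1 (hQX x hx (by simp))
      obtain ⟨P, hPX, hPF⟩ := hch.1.2.exists_path hκ (hun hX (hfin Q.verts)) hF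
      have hy : y ∉ P.verts.dropLast := by
        have := P.nodup
        rw [P.verts_eq_dropLast_append, List.nodup_append] at this
        exact fun h => this.2.2 y h y (by simp) rfl
      have hx : x ∈ P.verts.dropLast := by
        have h1 : x ∈ P.verts := List.mem_of_mem_head? P.head_eq
        rw [P.verts_eq_dropLast_append, List.mem_append] at h1
        exact h1.resolve_right (by simpa using hch.1.1)
      have hdis : P.verts.dropLast.Disjoint Q.verts := by
        intro v hvP hvQ
        rcases hPX v (List.mem_of_mem_dropLast hvP) (Or.inr hvQ) with rfl | rfl
        · exact hxQ hvQ
        · exact hy hvP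
      refine ⟨P.append Q hdis, ?_, ?_, ?_⟩
      · exact (List.singleton_sublist.2 hx).append hLQ
      · intro v hv hvX
        rcases List.mem_append.1 hv with hv | hv
        · rcases hPX v (List.mem_of_mem_dropLast hv) (Or.inl hvX) with rfl | rfl <;> simp
        · exact List.mem_cons_of_mem _ (hQX v hv (Or.inl hvX))
      · intro e he
        exact (List.mem_append.1 he).elim (hPF e) (hQF e)

theorem EdgeDisjoint.symm {a b a' b' : V} {P : G.Path a b} {Q : G.Path a' b'}
    (h : EdgeDisjoint P Q) : EdgeDisjoint Q P :=
  fun e hQ hP => h e hP hQ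

theorem OrderCompatible.symm {a b a' b' : V} {P : G.Path a b} {Q : G.Path a' b'}
    (h : OrderCompatible P Q) : OrderCompatible Q P :=
  fun u v h1 h2 h3 h4 => (h u v h3 h4 h1 h2).symm

end Multigraph

theorem List.Nodup.not_pair_sublist_swap {α : Type*} {M : List α} (h : M.Nodup) {u v : α}
    (huv : [u, v].Sublist M) : ¬ [v, u].Sublist M := by
  induction M with
  | nil => simp at huv
  | cons x M ih =>
    rw [List.nodup_cons] at h
    intro hvu
    rw [List.cons_sublist_cons'] at huv hvu
    rcases huv with huv | ⟨rfl, hv⟩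
    · rcases hvu with hvu | ⟨rfl, -⟩
      · exact ih h.2 huv hvu
      · exact h.1 (huv.subset (by simp))
    · rcases hvu with hvu | ⟨rfl, hu⟩
      · exact h.1 (hvu.subset (by simp))
      · exact h.1 (List.singleton_sublist.1 hu)

theorem List.pair_sublist_or_of_mem {α : Type*} {M : List α} {u v : α} (hu : u ∈ M)
    (hv : v ∈ M) (huv : u ≠ v) : [u, v].Sublist M ∨ [v, u].Sublist M := by
  induction M with
  | nil => simp at hu
  | cons x M ih =>
    rcases List.mem_cons.1 hu with rfl | hu'
    · exact Or.inl (by simpa using (List.mem_cons.1 hv).resolve_left huv.symm)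
    · rcases List.mem_cons.1 hv with rfl | hv'
      · exact Or.inr (by simpa using hu')
      · exact (ih hu' hv').imp (·.cons _) (·.cons _)

/-- In a duplicate-free list, two members of a sublist occur in the same order as in the
sublist. -/
theorem List.Sublist.pair_sublist_iff {α : Type*} {L M : List α} (h : L.Sublist M)
    (hM : M.Nodup) {u v : α} (hu : u ∈ L) (hv : v ∈ L) :
    [u, v].Sublist M ↔ [u, v].Sublist L := by
  refine ⟨fun huv => ?_, fun huv => huv.trans h⟩
  have hne : u ≠ v := by simpa using hM.sublist huv
  exact (List.pair_sublist_or_of_mem hu hv hne).resolve_right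
    fun hvu => hM.not_pair_sublist_swap huv (hvu.trans h)

theorem Cardinal.mk_setOf_exists_mem_list_lt {ι β : Type u} (f : ι → List β)
    {κ : Cardinal.{u}} (hι : Cardinal.mk ι < κ) (hκ : Cardinal.aleph0 < κ) :
    Cardinal.mk {v | ∃ i, v ∈ f i} < κ := by
  have : {v | ∃ i, v ∈ f i} = ⋃ i, {v | v ∈ f i} := by ext; simp
  rw [this]
  refine (Cardinal.mk_iUnion_le _).trans_lt ?_
  refine (mul_le_mul_right (ciSup_le' fun i => ?_) _).trans_lt (Cardinal.mul_lt_of_lt hκ.le hι hκ)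
  exact (Cardinal.mk_lt_aleph0_iff.2 (List.finite_toSet (f i))).le

/-- Transfinite recursion: along a well-founded relation, choices that can always be continued
can be made simultaneously. -/
theorem WellFounded.exists_forall_of_forall_exists {ι : Type*} {β : Type*}
    {r : ι → ι → Prop} (hr : WellFounded r) (R : ∀ i, (∀ j, r j i → β) → β → Prop)
    (h : ∀ i f, ∃ p, R i f p) : ∃ g : ι → β, ∀ i, R i (fun j _ => g j) (g i) := by
  choose c hc using h
  refine ⟨hr.fix c, fun i => ?_⟩
  rw [hr.fix_eq c i]
  exact hc i _

/-- **Lemma 2.2.**  Let `δ` be a singular cardinal, `(δ_α)_{α < cf δ}` an increasing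
sequence of regular cardinals converging to `δ` with `cf δ < δ₀`, and let `H_α` be the
simple graph on `V(G)` whose edges are the pairs `xy` with `κ_V(x,y) ≥ δ_α` in `G`.
If there is a choice of `a`–`b` paths `P_α` in `H_α` (here recorded by their vertex
lists `L α`) that are pairwise order-compatible, then `G` contains `δ` pairwise
edge-disjoint, pairwise order-compatible `a`–`b` paths. -/
theorem singular_auxiliary {V E : Type u} (G : Multigraph V E) (a b : V)
    (δ : Cardinal.{u}) (hδ : Cardinal.aleph0 ≤ δ) (hsing : δ.ord.cof < δ)
    (δseq : Ordinal.{u} → Cardinal.{u})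
    (hreg : ∀ α < δ.ord.cof.ord, (δseq α).IsRegular)
    (hmono : ∀ α β : Ordinal.{u}, α < β → β < δ.ord.cof.ord → δseq α < δseq β)
    (hconv : (⨆ α : {o : Ordinal.{u} // o < δ.ord.cof.ord}, δseq α.1) = δ)
    (h0 : δ.ord.cof < δseq 0)
    (L : Ordinal.{u} → List V)
    (hnodup : ∀ α < δ.ord.cof.ord, (L α).Nodup)
    (hhead : ∀ α < δ.ord.cof.ord, (L α).head? = some a)
    (hlast : ∀ α < δ.ord.cof.ord, (L α).getLast? = some b)
    (hedge : ∀ α < δ.ord.cof.ord,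
      (L α).Chain' fun x y => x ≠ y ∧ G.KappaVGe x y (δseq α))
    (hoc : ∀ α < δ.ord.cof.ord, ∀ β < δ.ord.cof.ord, α ≠ β →
      listOrderCompatible (L α) (L β)) :
    ∃ (ι : Type u) (P : ι → G.Path a b), Cardinal.mk ι = δ ∧
      (Pairwise fun i j => Multigraph.EdgeDisjoint (P i) (P j)) ∧
      (Pairwise fun i j => Multigraph.OrderCompatible (P i) (P j)) := by
  have hω : Cardinal.aleph0 ≤ δ.ord.cof :=
    Ordinal.aleph0_le_cof_iff.2 (Ordinal.one_lt_cof_iff.2 (Cardinal.isSuccLimit_ord hδ))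
  have hpos : 0 < δ.ord.cof.ord := by
    simpa using Cardinal.aleph0_pos.trans_le hω
  have hseq : ∀ α < δ.ord.cof.ord, δ.ord.cof < δseq α := fun α hα => by
    rcases eq_or_ne α 0 with rfl | h
    · exact h0
    · exact h0.trans (hmono 0 α (pos_iff_ne_zero.2 h) hα)
  obtain ⟨ι, hι⟩ : ∃ ι : Type u, Cardinal.mk ι = δ := ⟨_, Cardinal.mk_out δ⟩
  obtain ⟨r, _, hr⟩ := Cardinal.exists_ord_eq ι
  have hlevel : ∀ i, ∃ α < δ.ord.cof.ord, Cardinal.mk {j // r j i} < δseq α := by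
    intro i
    have hi : Cardinal.mk {j // r j i} < δ := hι ▸ Cardinal.card_typein_lt i hr
    have : Nonempty {o : Ordinal.{u} // o < δ.ord.cof.ord} := ⟨0, hpos⟩
    rw [← hconv] at hi
    obtain ⟨α, hα⟩ := exists_lt_of_lt_ciSup hi
    exact ⟨α.1, α.2, hα⟩
  choose lev hlev hcard using hlevel
  have hW : ∀ α < δ.ord.cof.ord,
      Cardinal.mk {v | ∃ β < δ.ord.cof.ord, v ∈ L β} < δseq α := by
    intro α hα
    have := Cardinal.mk_setOf_exists_mem_list_lt
      (fun t : δ.ord.cof.ord.ToType => L (Ordinal.ToType.mk.symm t).1)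
      (κ := δseq α) (by simpa using hseq α hα) (hω.trans_lt (hseq α hα))
    refine (Cardinal.mk_le_mk_of_subset ?_).trans_lt this
    rintro v ⟨β, hβ, hv⟩
    exact ⟨Ordinal.ToType.mk ⟨β, hβ⟩, by simpa using hv⟩
  obtain ⟨P, hP⟩ := (IsWellFounded.wf (r := r)).exists_forall_of_forall_exists
    (fun i (f : ∀ j, r j i → G.Path a b) (p : G.Path a b) => (L (lev i)).Sublist p.verts ∧
      (∀ v ∈ p.verts, ((∃ β < δ.ord.cof.ord, v ∈ L β) ∨ ∃ j h, v ∈ (f j h).verts) →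
        v ∈ L (lev i)) ∧ ∀ j h, Multigraph.EdgeDisjoint p (f j h)) (by
    intro i f
    have hinf := hω.trans_lt (hseq _ (hlev i))
    obtain ⟨p, h1, h2, h3⟩ := Multigraph.exists_path_of_isChain (G := G) hinf.le (L (lev i))
      (Cardinal.mk_setOf_exists_mem_list_lt (fun j : {j // r j i} => (f j.1 j.2).edges)
        (hcard i) hinf)
      ((Cardinal.mk_union_le _ _).trans_lt (Cardinal.add_lt_of_lt hinf.le (hW _ (hlev i))
        (Cardinal.mk_setOf_exists_mem_list_lt (fun j : {j // r j i} => (f j.1 j.2).verts)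
          (hcard i) hinf)))
      (hnodup _ (hlev i)) (hhead _ (hlev i)) (hlast _ (hlev i)) (hedge _ (hlev i))
    refine ⟨p, h1, fun v hv h => h2 v hv (h.imp_right ?_), fun j hj e he he' => ?_⟩
    · rintro ⟨j, hj, h⟩
      exact ⟨⟨j, hj⟩, h⟩
    · exact h3 e he ⟨⟨j, hj⟩, he'⟩)
  have hlt : ∀ i j, r j i → Multigraph.OrderCompatible (P i) (P j) := by
    intro i j hji u v hu hv hu' hv'
    have hi : ∀ w ∈ (P i).verts, w ∈ (P j).verts → w ∈ L (lev i) := fun w hw hw' =>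
      (hP i).2.1 w hw (Or.inr ⟨j, hji, hw'⟩)
    have hj : ∀ w ∈ (P i).verts, w ∈ (P j).verts → w ∈ L (lev j) := fun w hw hw' =>
      (hP j).2.1 w hw' (Or.inl ⟨lev i, hlev i, hi w hw hw'⟩)
    have hui := hi u hu hu'
    have hvi := hi v hv hv'
    have huj := hj u hu hu'
    have hvj := hj v hv hv'
    rw [(hP i).1.pair_sublist_iff (P i).nodup hui hvi,
      (hP j).1.pair_sublist_iff (P j).nodup huj hvj]
    by_cases hl : lev i = lev j
    · rw [hl]
    · exact hoc _ (hlev i) _ (hlev j) hl u v hui hvi huj hvj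
  refine ⟨ι, P, hι, fun i j hij => ?_, fun i j hij => ?_⟩
  · rcases trichotomous_of r i j with h | h | h
    · exact ((hP j).2.2 i h).symm
    · exact (hij h).elim
    · exact (hP i).2.2 j h
  · rcases trichotomous_of r i j with h | h | h
    · exact (hlt j i h).symm
    · exact (hij h).elim
    · exact hlt i j h
end

section
/- Let G be a graph (possibly with parallel edges) and let a, b, c be distinct vertices of G. Let 𝒫_{a,b} be a countably infinite family of pairwise edge-disjoint, pairwise order-compatible a–b paths and 𝒫_{b,c} a countably infinite family of pairwise edge-disjoint, pairwise order-compatible b–c paths, and let 𝒫 ⊆ 𝒫_{a,b} and 𝒬 ⊆ 𝒫_{b,c} be infinite subfamilies. If no pair of infinite subfamilies 𝒫′ ⊆ 𝒫 and 𝒬′ ⊆ 𝒬 admits a (𝒫′,𝒬′)-terminal, then G contains a countably infinite family of pairwise edge-disjoint, pairwise order-compatible a–c paths. -/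
universe u

/-- `v` is a `(𝒫,𝒬)`-terminal for a family `Pab` of `a`–`b` paths and a family `Qbc` of
`b`–`c` paths: `v` lies on some path of `Pab`, `v` lies on every path `Q ∈ Qbc`, and for
every `Q ∈ Qbc` the subpath of `Q` from `v` to `c` meets the union of the vertex sets of
the paths in `Pab` exactly in `{v}` (i.e. no vertex of `Q` strictly after `v` lies on a
path of `Pab`). -/
def Multigraph.IsTerminal {V E : Type u} {G : Multigraph V E} {a b c : V}
    (Pab : Set (G.Path a b)) (Qbc : Set (G.Path b c)) (v : V) : Prop :=
  (∃ P ∈ Pab, v ∈ P.verts) ∧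
    ∀ Q ∈ Qbc, v ∈ Q.verts ∧ ∀ x, [v, x].Sublist Q.verts → ∀ P ∈ Pab, x ∉ P.verts

namespace Multigraph

variable {V E : Type u} {G : Multigraph V E}

theorem Path.mem_verts_of_mem_ends {a b : V} (P : G.Path a b) {e : E} (he : e ∈ P.edges)
    {x : V} (hx : x ∈ G.ends e) : x ∈ P.verts := by
  obtain ⟨i, hi, rfl⟩ := List.getElem_of_mem he
  have hl := P.length_eq
  rw [P.inc i (by omega), Sym2.mem_iff] at hx
  rcases hx with rfl | rfl <;> exact List.getElem_mem _

theorem Path.edges_ne_nil {a b : V} (hab : a ≠ b) (P : G.Path a b) : P.edges ≠ [] := by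
  intro h
  have hl := P.length_eq
  rw [h] at hl
  obtain ⟨x, hx⟩ := List.length_eq_one_iff.1 hl
  have h₁ := P.head_eq
  have h₂ := P.last_eq
  simp_all

theorem Path.left_mem {a b : V} (P : G.Path a b) : a ∈ P.verts :=
  List.mem_of_mem_head? P.head_eq

theorem Path.right_mem {a b : V} (P : G.Path a b) : b ∈ P.verts :=
  List.mem_of_mem_getLast? P.last_eq

/-- Follow `P` up to a vertex `w` and then `Q` from `w` on. -/
theorem Path.exists_splice {a b b' c : V} (P : G.Path a b) (Q : G.Path b' c) {w : V}
    {p₁ p₂ q₁ q₂ : List V} (hP : P.verts = p₁ ++ w :: p₂) (hQ : Q.verts = q₁ ++ w :: q₂)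
    (hd : ∀ x ∈ q₂, x ∉ P.verts) :
    ∃ R : G.Path a c, R.verts = p₁ ++ w :: q₂ ∧
      ∀ e ∈ R.edges, e ∈ P.edges ∨ e ∈ Q.edges ∧ ∃ x ∈ q₂, x ∈ G.ends e := by
  have hPl := P.length_eq
  have hQl := Q.length_eq
  have hPl' : p₁.length + p₂.length = P.edges.length := by
    rw [hP] at hPl; simp at hPl; omega
  have hQl' : q₁.length + q₂.length = Q.edges.length := by
    rw [hQ] at hQl; simp at hQl; omega
  refine ⟨⟨p₁ ++ w :: q₂, P.edges.take p₁.length ++ Q.edges.drop q₁.length, ?_, ?_, ?_, ?_, ?_⟩,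
    rfl, ?_⟩
  · have h₁ := P.nodup
    have h₂ := Q.nodup
    rw [hP] at h₁ hd
    rw [hQ] at h₂
    grind [List.nodup_append, List.nodup_cons]
  · simp; omega
  · have := P.head_eq
    rw [hP] at this
    cases p₁ <;> simpa using this
  · have := Q.last_eq
    rw [hQ] at this
    simpa [List.getLast?_append, List.getLast?_cons] using this
  · intro i hi
    simp only [List.length_append, List.length_cons] at hi
    by_cases h : i < p₁.length
    · have := P.inc i (by omega)
      simp only [hP] at this
      grind
    · have := Q.inc (i - p₁.length + q₁.length) (by omega)
      simp only [hQ] at this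
      grind
  · intro e he
    rcases List.mem_append.1 he with he | he
    · exact .inl (List.mem_of_mem_take he)
    · refine .inr ⟨List.mem_of_mem_drop he, ?_⟩
      obtain ⟨i, hi, rfl⟩ := List.getElem_of_mem he
      simp only [List.length_drop] at hi
      have := Q.inc (q₁.length + i) (by omega)
      simp only [hQ] at this
      refine ⟨q₂[i]'(by omega), List.getElem_mem _, ?_⟩
      rw [List.getElem_drop, this, Sym2.mem_iff]
      right
      grind

end Multigraph

theorem List.pair_sublist_append_iff {α : Type*} {u v : α} {A B : List α} :
    [u, v].Sublist (A ++ B) ↔ [u, v].Sublist A ∨ (u ∈ A ∧ v ∈ B) ∨ [u, v].Sublist B := by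
  constructor
  · intro h
    obtain ⟨l₁, l₂, hl, h₁, h₂⟩ := List.sublist_append_iff.1 h
    match l₁, hl with
    | [], hl => simp at hl; subst hl; exact .inr (.inr h₂)
    | [x], hl => simp at hl; obtain ⟨rfl, rfl⟩ := hl; simp_all
    | [x, y], hl => simp at hl; obtain ⟨rfl, rfl, rfl⟩ := hl; exact .inl h₁
    | x :: y :: z :: l, hl => simp at hl
  · rintro (h | ⟨hu, hv⟩ | h)
    · exact h.trans (List.sublist_append_left _ _)
    · exact (List.singleton_sublist.2 hu).append (List.singleton_sublist.2 hv)
    · exact h.trans (List.sublist_append_right _ _)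

theorem List.exists_eq_append_cons_last {α : Type*} (p : α → Prop) (l : List α)
    (h : ∃ x ∈ l, p x) : ∃ l₁ w l₂, l = l₁ ++ w :: l₂ ∧ p w ∧ ∀ x ∈ l₂, ¬ p x := by
  induction l with
  | nil => simp at h
  | cons y l ih =>
    by_cases hl : ∃ x ∈ l, p x
    · obtain ⟨l₁, w, l₂, rfl, hw⟩ := ih hl
      exact ⟨y :: l₁, w, l₂, rfl, hw⟩
    · push Not at hl
      refine ⟨[], y, l, rfl, ?_, hl⟩
      obtain ⟨x, hx, hpx⟩ := h
      rcases List.mem_cons.1 hx with rfl | hx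
      · exact hpx
      · exact absurd hpx (hl x hx)

theorem exists_strictMono_pairs {D S : ℕ → ℕ → Prop} (hle : ∀ k j, k ≤ j → D k j)
    (hev : ∀ j, ∃ N, ∀ k ≥ N, D k j) (hS : ∀ N, ∃ k ≥ N, ∃ j ≥ N, S k j ∧ D k j) :
    ∃ f g : ℕ → ℕ, StrictMono f ∧ StrictMono g ∧ (∀ n, S (f n) (g n)) ∧
      ∀ n m, D (f n) (g m) := by
  choose B hB using hev
  choose k hk j hj hSk hD using hS
  let N : ℕ → ℕ := fun n => n.rec 0 fun _ N => max (max (k N + 1) (j N + 1)) (B (j N))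
  have hN : ∀ n, N (n + 1) = max (max (k (N n) + 1) (j (N n) + 1)) (B (j (N n))) := fun _ => rfl
  have hmono : StrictMono N := strictMono_nat_of_lt_succ fun n => by
    have := hk (N n); have := hN n; omega
  refine ⟨fun n => k (N n), fun n => j (N n), strictMono_nat_of_lt_succ fun n => ?_,
    strictMono_nat_of_lt_succ fun n => ?_, fun n => hSk _, fun n m => ?_⟩
  · have := hk (N (n + 1)); have := hN n; omega
  · have := hj (N (n + 1)); have := hN n; omega
  · change D (k (N n)) (j (N m))
    rcases lt_trichotomy n m with h | rfl | h
    · have h₁ : N (n + 1) ≤ N m := hmono.monotone h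
      have := hj (N m); have := hN n
      exact hle _ _ (by omega)
    · exact hD _
    · have h₁ : N (m + 1) ≤ N n := hmono.monotone h
      have := hk (N n); have := hN m
      exact hB _ _ (by omega)

namespace Multigraph

variable {V E : Type u} {G : Multigraph V E}

/-- Splicing each `p n` with `q n` at a common vertex `w n`, such that no path `p m` is met by
the part of `q n` after `w n`, yields pairwise edge-disjoint and order-compatible paths. -/
theorem exists_family_of_splices {a b c : V} (hac : a ≠ c)
    (p : ℕ → G.Path a b) (q : ℕ → G.Path b c)
    (hpd : Pairwise fun n m => EdgeDisjoint (p n) (p m))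
    (hpo : Pairwise fun n m => OrderCompatible (p n) (p m))
    (hqd : Pairwise fun n m => EdgeDisjoint (q n) (q m))
    (hqo : Pairwise fun n m => OrderCompatible (q n) (q m))
    (w : ℕ → V) (q₁ q₂ : ℕ → List V) (hq : ∀ n, (q n).verts = q₁ n ++ w n :: q₂ n)
    (hw : ∀ n, w n ∈ (p n).verts) (hd : ∀ n m, ∀ x ∈ q₂ m, x ∉ (p n).verts) :
    ∃ R : Set (G.Path a c), R.Countable ∧ R.Infinite ∧
      R.Pairwise EdgeDisjoint ∧ R.Pairwise OrderCompatible := by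
  choose p₁ p₂ hp using fun n => List.append_of_mem (hw n)
  choose R hR hRe using fun n => (p n).exists_splice (q n) (hp n) (hq n) (hd n n)
  have hdisj : Pairwise fun n m => EdgeDisjoint (R n) (R m) := by
    intro n m hnm e hn hm
    rcases hRe n e hn with h₁ | ⟨h₁, x, hx, hxe⟩ <;> rcases hRe m e hm with h₂ | ⟨h₂, y, hy, hye⟩
    · exact hpd hnm e h₁ h₂
    · exact hd n m y hy ((p n).mem_verts_of_mem_ends h₁ hye)
    · exact hd m n x hx ((p m).mem_verts_of_mem_ends h₂ hxe)
    · exact hqd hnm e h₁ h₂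
  have hinj : Function.Injective R := by
    intro n m h
    by_contra hnm
    obtain ⟨e, he⟩ := List.exists_mem_of_ne_nil _ ((R n).edges_ne_nil hac)
    exact hdisj hnm e he (h ▸ he)
  have hord : Pairwise fun n m => OrderCompatible (R n) (R m) := by
    intro n m hnm u v
    have hA : ∀ k, ∃ A, (R k).verts = A ++ q₂ k ∧ (p k).verts = A ++ p₂ k :=
      fun k => ⟨p₁ k ++ [w k], by simp [hR], by simp [hp]⟩
    have hB : ∀ k, ∃ B, (q k).verts = B ++ q₂ k := fun k => ⟨q₁ k ++ [w k], by simp [hq]⟩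
    choose A hA hAp using hA
    choose B hB using hB
    have hpn := hpo hnm u v
    have hqn := hqo hnm u v
    have hAd : ∀ k l x, x ∈ q₂ l → x ∉ A k := fun k l x hx hxk =>
      hd k l x hx (by simp [hAp, hxk])
    have hpnd : ∀ k x, x ∈ A k → x ∉ p₂ k := fun k x h₁ h₂ => by
      have := (p k).nodup
      rw [hAp, List.nodup_append] at this
      exact this.2.2 x h₁ x h₂ rfl
    have hqnd : ∀ k x, x ∈ q₂ k → x ∉ B k := fun k x h₁ h₂ => by
      have := (q k).nodup
      rw [hB, List.nodup_append] at this
      exact this.2.2 x h₂ x h₁ rfl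
    have hsub : ∀ l : List V, [u, v].Sublist l → u ∈ l ∧ v ∈ l := fun l h =>
      ⟨h.subset (by simp), h.subset (by simp)⟩
    simp only [hA, hAp, hB, List.mem_append, List.pair_sublist_append_iff] at hpn hqn ⊢
    have := hsub (A n); have := hsub (A m); have := hsub (q₂ n); have := hsub (q₂ m)
    have := hsub (p₂ n); have := hsub (p₂ m); have := hsub (B n); have := hsub (B m)
    have := hpnd n u; have := hpnd n v; have := hpnd m u; have := hpnd m v
    have := hqnd n u; have := hqnd n v; have := hqnd m u; have := hqnd m v
    have := hAd n n u; have := hAd n n v; have := hAd m m u; have := hAd m m v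
    have := hAd n m u; have := hAd n m v; have := hAd m n u; have := hAd m n v
    clear hsub hAd hpnd hqnd
    grind
  refine ⟨Set.range R, Set.countable_range R, Set.infinite_range_of_injective hinj, ?_, ?_⟩
  · rintro _ ⟨n, rfl⟩ _ ⟨m, rfl⟩ h
    exact hdisj fun hnm => h (congrArg R hnm)
  · rintro _ ⟨n, rfl⟩ _ ⟨m, rfl⟩ h
    exact hord fun hnm => h (congrArg R hnm)

end Multigraph

/-- **Lemma 3.3.**  If no pair of infinite subfamilies `P'' ⊆ P'` and `Q'' ⊆ Q'` admits a
`(P'',Q'')`-terminal, then `G` contains a countably infinite family of pairwise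
edge-disjoint, pairwise order-compatible `a`–`c` paths. -/
theorem no_terminals {V E : Type u} (G : Multigraph V E) (a b c : V)
    (hab : a ≠ b) (hac : a ≠ c) (hbc : b ≠ c)
    (Pab : Set (G.Path a b)) (hPcount : Pab.Countable) (hPinf : Pab.Infinite)
    (hPdisj : Pab.Pairwise Multigraph.EdgeDisjoint)
    (hPoc : Pab.Pairwise Multigraph.OrderCompatible)
    (Qbc : Set (G.Path b c)) (hQcount : Qbc.Countable) (hQinf : Qbc.Infinite)
    (hQdisj : Qbc.Pairwise Multigraph.EdgeDisjoint)
    (hQoc : Qbc.Pairwise Multigraph.OrderCompatible)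
    (P' : Set (G.Path a b)) (hP'sub : P' ⊆ Pab) (hP'inf : P'.Infinite)
    (Q' : Set (G.Path b c)) (hQ'sub : Q' ⊆ Qbc) (hQ'inf : Q'.Infinite)
    (hnoterm : ∀ P'' ⊆ P', ∀ Q'' ⊆ Q', P''.Infinite → Q''.Infinite →
      ¬ ∃ v : V, Multigraph.IsTerminal P'' Q'' v) :
    ∃ Rac : Set (G.Path a c), Rac.Countable ∧ Rac.Infinite ∧
      Rac.Pairwise Multigraph.EdgeDisjoint ∧
      Rac.Pairwise Multigraph.OrderCompatible := by
  let p : ℕ → G.Path a b := fun n => hP'inf.natEmbedding P' n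
  let q : ℕ → G.Path b c := fun n => hQ'inf.natEmbedding Q' n
  have hp : ∀ n, p n ∈ P' := fun n => (hP'inf.natEmbedding P' n).2
  have hq : ∀ n, q n ∈ Q' := fun n => (hQ'inf.natEmbedding Q' n).2
  have hpinj : Function.Injective p := Subtype.val_injective.comp (hP'inf.natEmbedding P').injective
  have hqinj : Function.Injective q := Subtype.val_injective.comp (hQ'inf.natEmbedding Q').injective
  let U : V → Prop := fun x => ∀ N, ∃ k ≥ N, x ∈ (p k).verts
  have hlast := fun j => List.exists_eq_append_cons_last
    (fun x => U x ∨ ∃ k ≤ j, x ∈ (p k).verts) (q j).verts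
    ⟨b, (q j).left_mem, .inl fun N => ⟨N, le_rfl, (p N).right_mem⟩⟩
  choose q₁ w q₂ hqw hw hq₂ using hlast
  let D : ℕ → ℕ → Prop := fun k j => ∀ x ∈ q₂ j, x ∉ (p k).verts
  have hle : ∀ k j, k ≤ j → D k j := fun k j hkj x hx hxk => hq₂ j x hx (.inr ⟨k, hkj, hxk⟩)
  have hev : ∀ j, ∃ N, ∀ k ≥ N, D k j := by
    intro j
    have h : ∀ x ∈ {x | x ∈ q₂ j}, ∀ᶠ k in Filter.atTop, x ∉ (p k).verts := by
      intro x hx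
      have hU : ¬ U x := fun h => hq₂ j x hx (.inl h)
      simp only [U] at hU
      push Not at hU
      exact Filter.eventually_atTop.2 hU
    exact Filter.eventually_atTop.1 ((Filter.eventually_all_finite (List.finite_toSet _)).2 h)
  by_cases hS : ∀ N, ∃ k ≥ N, ∃ j ≥ N, w j ∈ (p k).verts ∧ D k j
  · obtain ⟨f, g, hf, hg, hfg, hD⟩ := exists_strictMono_pairs hle hev hS
    have hpne : Pairwise fun n m => p (f n) ≠ p (f m) := fun n m h => (hpinj.comp hf.injective).ne h
    have hqne : Pairwise fun n m => q (g n) ≠ q (g m) := fun n m h => (hqinj.comp hg.injective).ne h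
    exact Multigraph.exists_family_of_splices hac (p ∘ f) (q ∘ g)
      (fun n m h => hPdisj (hP'sub (hp _)) (hP'sub (hp _)) (hpne h))
      (fun n m h => hPoc (hP'sub (hp _)) (hP'sub (hp _)) (hpne h))
      (fun n m h => hQdisj (hQ'sub (hq _)) (hQ'sub (hq _)) (hqne h))
      (fun n m h => hQoc (hQ'sub (hq _)) (hQ'sub (hq _)) (hqne h))
      (w ∘ g) (q₁ ∘ g) (q₂ ∘ g) (fun n => hqw _) hfg hD
  · exfalso
    push Not at hS
    obtain ⟨N, hN⟩ := hS
    have hwN : ∀ j ≥ N, ∃ k < N, w j ∈ (p k).verts := by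
      intro j hj
      rcases hw j with h | ⟨k, hk, h⟩
      · obtain ⟨B, hB⟩ := hev j
        obtain ⟨k, hk, h⟩ := h (max N B)
        exact absurd (hB k (le_of_max_le_right hk)) (hN k (le_of_max_le_left hk) j hj h)
      · exact ⟨k, by_contra fun hkN => hN k (not_lt.1 hkN) j hj h (hle k j hk), h⟩
    have hfin : (⋃ k ∈ Set.Iio N, {x | x ∈ (p k).verts}).Finite :=
      (Set.finite_Iio N).biUnion fun k _ => List.finite_toSet _
    obtain ⟨x, hx, hxinf⟩ : ∃ x ∈ ⋃ k ∈ Set.Iio N, {x | x ∈ (p k).verts},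
        (Set.Ici N ∩ {j | w j = x}).Infinite := by
      by_contra! h
      refine Set.Ici_infinite N ((hfin.biUnion h).subset fun j hj => ?_)
      obtain ⟨k, hk, hjk⟩ := hwN j hj
      exact Set.mem_biUnion (Set.mem_biUnion (Set.mem_Iio.2 hk) hjk) ⟨hj, rfl⟩
    simp only [Set.mem_iUnion, Set.mem_Iio, exists_prop] at hx
    obtain ⟨k₀, hk₀, hxk⟩ := hx
    obtain ⟨f, g, hf, hg, hfg, hD⟩ := exists_strictMono_pairs (S := fun _ j => N ≤ j ∧ w j = x)
      hle hev fun M => by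
        obtain ⟨j, hj, hMj⟩ := hxinf.exists_gt M
        exact ⟨M, le_rfl, j, hMj.le, hj, hle _ _ hMj.le⟩
    refine hnoterm (insert (p k₀) (Set.range (p ∘ f))) ?_ (Set.range (q ∘ g)) ?_
      ((Set.infinite_range_of_injective (hpinj.comp hf.injective)).mono (Set.subset_insert _ _))
      (Set.infinite_range_of_injective (hqinj.comp hg.injective))
      ⟨x, ⟨p k₀, Set.mem_insert _ _, hxk⟩, ?_⟩
    · rintro _ (rfl | ⟨n, rfl⟩) <;> exact hp _
    · rintro _ ⟨n, rfl⟩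
      exact hq _
    · rintro _ ⟨n, rfl⟩
      obtain ⟨hNn, rfl⟩ := hfg n
      refine ⟨by simp [hqw], fun y hy P hP => ?_⟩
      have hy₂ : y ∈ q₂ (g n) := by
        have hnd := (q (g n)).nodup
        simp only [Function.comp_apply, hqw] at hy hnd
        rw [List.pair_sublist_append_iff] at hy
        rw [List.nodup_append] at hnd
        rcases hy with hy | ⟨hy, -⟩ | hy
        · exact absurd rfl (hnd.2.2 _ (hy.subset List.mem_cons_self) _ List.mem_cons_self)
        · exact absurd rfl (hnd.2.2 _ hy _ List.mem_cons_self)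
        · exact List.singleton_sublist.1 (List.cons_sublist_cons.1 hy)
      rcases hP with rfl | ⟨m, rfl⟩
      · exact hle _ _ (hk₀.le.trans hNn) y hy₂
      · exact hD m n y hy₂
end
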